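/- Let p ∈ ℂ[t] with deg p ≥ 2. Then S_p does not have the concatenability property: there exist continuously differentiable u₁, u₂ ∈ S_p with u₁(0) = u₂(0) such that u₁⌢u₂ ∉ S_p. -/

import Mathlib

open MeasureTheory Filter Topology

/-- `u` satisfies `p(d/dt) u = 0` in the sense of distributions: for every test function `φ`
(infinitely differentiable with compact support),
`∑ₖ aₖ (−1)ᵏ ∫ u(t) φ⁽ᵏ⁾(t) dt = 0`, where `p = ∑ₖ aₖ tᵏ`. -/
def IsDistSol (p : Polynomial ℂ) (u : ℝ → ℂ) : Prop :=
  ∀ φ : ℝ → ℂ, ContDiff ℝ (⊤ : ℕ∞) φ → HasCompactSupport φ →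
    ∑ k ∈ Finset.range (p.natDegree + 1),
      p.coeff k * ((-1 : ℂ) ^ k * ∫ t : ℝ, u t * iteratedDeriv k φ t) = 0

/-- Membership in `S_p`: `u` is continuous and solves `p(d/dt) u = 0` distributionally. -/
def MemSp (p : Polynomial ℂ) (u : ℝ → ℂ) : Prop :=
  Continuous u ∧ IsDistSol p u

/-- The concatenation `u₁ ⌢ u₂`: equal to `u₁(t)` for `t ≤ 0` and to `u₂(t)` for `t ≥ 0`
(when `u₁ 0 = u₂ 0` this matches both requirements). -/
noncomputable def concat (u₁ u₂ : ℝ → ℂ) : ℝ → ℂ := fun t => if t ≤ 0 then u₁ t else u₂ t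

/-- `S_p` has the concatenability property. -/
def Concatenable (p : Polynomial ℂ) : Prop :=
  ∀ u₁ u₂ : ℝ → ℂ, MemSp p u₁ → MemSp p u₂ →
    ContDiff ℝ 1 u₁ → ContDiff ℝ 1 u₂ → u₁ 0 = u₂ 0 →
    MemSp p (concat u₁ u₂)



/-- The space of complex test functions on the line. -/
def TF : Submodule ℂ (ℝ → ℂ) where
  carrier := {φ | ContDiff ℝ (⊤ : ℕ∞) φ ∧ HasCompactSupport φ}
  add_mem' := fun ha hb => ⟨ha.1.add hb.1, ha.2.add hb.2⟩
  zero_mem' := ⟨contDiff_const, HasCompactSupport.zero⟩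
  smul_mem' := fun c _ hf => ⟨hf.1.const_smul c, hf.2.smul_left (f := fun _ => c)⟩

theorem TF.diff (φ : TF) : Differentiable ℝ φ.1 := φ.2.1.differentiable (by simp)

/-- Minus the derivative, acting on test functions. -/
noncomputable def nD : Module.End ℂ TF where
  toFun φ := ⟨fun t => - deriv φ.1 t, by
    refine ⟨?_, ?_⟩
    · have h : ContDiff ℝ (⊤ : ℕ∞) (deriv φ.1) := (contDiff_infty_iff_deriv.1 φ.2.1).2
      exact h.neg
    · exact φ.2.2.deriv.neg⟩
  map_add' a b := by
    ext t
    have := deriv_add (TF.diff a t) (TF.diff b t)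
    simp [this]; ring
  map_smul' c a := by
    ext t
    have := deriv_const_smul c (TF.diff a t)
    simp [this]

theorem nD_apply (φ : TF) (t : ℝ) : (nD φ).1 t = - deriv φ.1 t := rfl

theorem nD_pow (k : ℕ) (φ : TF) : ((nD ^ k) φ).1 = fun t => (-1 : ℂ) ^ k * iteratedDeriv k φ.1 t := by
  induction k with
  | zero => ext t; simp
  | succ k ih =>
    ext t
    rw [pow_succ', Module.End.mul_apply, nD_apply, ih, iteratedDeriv_succ]
    rw [deriv_const_mul_field]
    ring

theorem aeval_nD (p : Polynomial ℂ) (φ : TF) (t : ℝ) :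
    (Polynomial.aeval nD p φ).1 t = ∑ k ∈ Finset.range (p.natDegree + 1),
      p.coeff k * ((-1 : ℂ) ^ k * iteratedDeriv k φ.1 t) := by
  rw [Polynomial.aeval_eq_sum_range]
  simp only [LinearMap.sum_apply, LinearMap.smul_apply, Submodule.coe_sum, Submodule.coe_smul,
    Finset.sum_apply, Pi.smul_apply, nD_pow, smul_eq_mul]

theorem isDistSol_iff (p : Polynomial ℂ) (u : ℝ → ℂ) (hu : Continuous u) :
    IsDistSol p u ↔ ∀ φ : TF, ∫ t : ℝ, u t * (Polynomial.aeval nD p φ).1 t = 0 := by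
  have key : ∀ φ : TF, ∫ t : ℝ, u t * (Polynomial.aeval nD p φ).1 t =
      ∑ k ∈ Finset.range (p.natDegree + 1),
      p.coeff k * ((-1 : ℂ) ^ k * ∫ t : ℝ, u t * iteratedDeriv k φ.1 t) := by
    intro φ
    simp only [aeval_nD, Finset.mul_sum]
    rw [integral_finsetSum]
    · refine Finset.sum_congr rfl fun k _ => ?_
      rw [← integral_const_mul, ← integral_const_mul]
      congr 1; ext t; ring
    · intro k _
      have h1 := ((nD ^ k) φ).2.1.continuous
      have h2 : HasCompactSupport ((nD ^ k) φ).1 := ((nD ^ k) φ).2.2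
      rw [nD_pow] at h1 h2
      exact (hu.mul (continuous_const.mul h1)).integrable_of_hasCompactSupport
        ((h2.mul_left (f := fun _ => p.coeff k)).mul_left (f := u))
  constructor
  · intro h φ
    rw [key]; exact h φ.1 φ.2.1 φ.2.2
  · intro h φ h1 h2
    rw [← key ⟨φ, h1, h2⟩]; exact h _

theorem exists_v (l m : ℂ) : ∃ v v' : ℝ → ℂ, (∀ t, HasDerivAt v (v' t) t) ∧
    (∀ t, HasDerivAt v' ((l + m) * v' t - l * m * v t) t) ∧ v 0 = 0 ∧ v' 0 ≠ 0 := by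
  have hexp : ∀ (a : ℂ) (t : ℝ), HasDerivAt (fun s : ℝ => Complex.exp (a * s))
      (Complex.exp (a * t) * a) t := by
    intro a t
    have h : HasDerivAt (fun s : ℝ => a * (s : ℂ)) a t := by
      simpa using (Complex.ofRealCLM.hasDerivAt (x := t)).const_mul a
    exact h.cexp
  by_cases hlm : l = m
  · subst hlm
    have hid : ∀ t : ℝ, HasDerivAt (fun s : ℝ => (s : ℂ)) 1 t := fun t => by
      simpa using HasDerivAt.ofReal_comp (hasDerivAt_id t)
    refine ⟨fun t => t * Complex.exp (l * t), fun t => (1 + l * t) * Complex.exp (l * t),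
      fun t => ?_, fun t => ?_, by simp, by simp⟩
    · refine ((hid t).mul (hexp l t)).congr_deriv ?_
      ring
    · refine ((((hid t).const_mul l).const_add 1).mul (hexp l t)).congr_deriv ?_
      ring
  · refine ⟨fun t => Complex.exp (l * t) - Complex.exp (m * t),
      fun t => Complex.exp (l * t) * l - Complex.exp (m * t) * m,
      fun t => (hexp l t).sub (hexp m t), fun t => ?_, by simp, by simpa [sub_eq_zero] using hlm⟩
    refine (((hexp l t).mul_const l).sub ((hexp m t).mul_const m)).congr_deriv ?_
    ring

theorem exists_test (q : Polynomial ℂ) (hq : q ≠ 0) :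
    ∃ φ : TF, (Polynomial.aeval nD q φ).1 0 ≠ 0 := by
  obtain ⟨b, hb⟩ : ∃ b, q.eval b ≠ 0 := by
    by_contra! h
    exact hq (Polynomial.funext (by simpa using h))
  let f : ContDiffBump (0 : ℝ) := ⟨1, 2, by norm_num, by norm_num⟩
  let e : ℝ → ℂ := fun t => Complex.exp ((-b) * t)
  have hexp : ∀ (a : ℂ) (t : ℝ), HasDerivAt (fun s : ℝ => Complex.exp (a * s))
      (Complex.exp (a * t) * a) t := by
    intro a t
    have h : HasDerivAt (fun s : ℝ => a * (s : ℂ)) a t := by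
      simpa using (Complex.ofRealCLM.hasDerivAt (x := t)).const_mul a
    exact h.cexp
  have he : ContDiff ℝ (⊤ : ℕ∞) e :=
    (contDiff_const.mul Complex.ofRealCLM.contDiff).cexp
  have hf : ContDiff ℝ (⊤ : ℕ∞) (fun t => (f t : ℂ)) := Complex.ofRealCLM.contDiff.comp f.contDiff
  have hfc : HasCompactSupport (fun t => (f t : ℂ)) :=
    f.hasCompactSupport.comp_left (g := fun x : ℝ => (x : ℂ)) (by simp)
  have hit : ∀ k, iteratedDeriv k e = fun t => (-b) ^ k * e t := by
    intro k
    induction k with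
    | zero => ext t; simp
    | succ k ih =>
      ext t
      rw [iteratedDeriv_succ, ih, deriv_const_mul_field, (hexp (-b) t).deriv]
      simp only [e]; ring
  refine ⟨⟨fun t => f t * e t, hf.mul he, hfc.mul_right⟩, ?_⟩
  rw [aeval_nD]
  have hev : (fun t => (f t : ℂ) * e t) =ᶠ[𝓝 0] e := by
    filter_upwards [f.eventuallyEq_one] with t ht
    simp [ht]
  convert hb using 1
  rw [Polynomial.eval_eq_sum_range]
  refine Finset.sum_congr rfl fun k _ => ?_
  simp only []
  rw [hev.iteratedDeriv_eq k, hit]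
  simp only [e, Complex.ofReal_zero, mul_zero, Complex.exp_zero, mul_one]
  rw [← mul_pow]; simp

theorem pairing (l m : ℂ) (v v' : ℝ → ℂ) (h1 : ∀ t, HasDerivAt v (v' t) t)
    (h2 : ∀ t, HasDerivAt v' ((l + m) * v' t - l * m * v t) t) (h0 : v 0 = 0) (ψ : TF) :
    (∫ t : ℝ, v t *
      (Polynomial.aeval nD ((Polynomial.X - Polynomial.C l) * (Polynomial.X - Polynomial.C m)) ψ).1 t
        = 0) ∧
    (∫ t in Set.Ioi (0 : ℝ), v t *
      (Polynomial.aeval nD ((Polynomial.X - Polynomial.C l) * (Polynomial.X - Polynomial.C m)) ψ).1 t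
        = v' 0 * ψ.1 0) := by
  set A := Polynomial.aeval nD ((Polynomial.X - Polynomial.C l) * (Polynomial.X - Polynomial.C m)) ψ
    with hA
  have hAt : ∀ t, A.1 t = deriv (deriv ψ.1) t + (l + m) * deriv ψ.1 t + l * m * ψ.1 t := by
    intro t
    have hd : deriv (nD ψ).1 t = - deriv (deriv ψ.1) t := by
      have : (nD ψ).1 = fun t => - deriv ψ.1 t := rfl
      rw [this, deriv.fun_neg]
    have : A = nD (nD ψ) - (l + m) • nD ψ + (l * m) • ψ := by
      rw [hA]
      simp only [map_mul, map_sub, Polynomial.aeval_X, Polynomial.aeval_C, Module.End.mul_apply,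
        LinearMap.sub_apply, Module.algebraMap_end_apply, map_smul]
      module
    rw [this]
    simp only [Submodule.coe_add, Submodule.coe_sub, Submodule.coe_smul, Pi.add_apply, Pi.sub_apply,
      Pi.smul_apply, nD_apply, hd, smul_eq_mul]
    ring
  have hψ' : ContDiff ℝ (⊤ : ℕ∞) (deriv ψ.1) := (contDiff_infty_iff_deriv.1 ψ.2.1).2
  have hψc : HasCompactSupport ψ.1 := ψ.2.2
  let G : ℝ → ℂ := fun t => v t * deriv ψ.1 t + ((l + m) * v t - v' t) * ψ.1 t
  have hG : ∀ t, HasDerivAt G (v t * A.1 t) t := by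
    intro t
    have a1 := (TF.diff ψ t).hasDerivAt
    have a2 := ((hψ'.differentiable (by simp)) t).hasDerivAt
    refine (((h1 t).mul a2).add ((((h1 t).const_mul (l + m)).sub (h2 t)).mul a1)).congr_deriv ?_
    rw [hAt]
    simp
    ring
  have hGd : deriv G = fun t => v t * A.1 t := funext fun t => (hG t).deriv
  have hGc : HasCompactSupport G := (hψc.deriv.mul_left (f := v)).add
    (hψc.mul_left (f := fun t => (l + m) * v t - v' t))
  have hvc : Continuous v := continuous_iff_continuousAt.2 fun t => (h1 t).continuousAt
  have hG1 : ContDiff ℝ 1 G := by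
    rw [contDiff_one_iff_deriv]
    refine ⟨fun t => (hG t).differentiableAt, ?_⟩
    rw [hGd]
    exact hvc.mul A.2.1.continuous
  constructor
  · exact integral_eq_zero_of_hasDerivAt_of_integrable hG
      ((hvc.mul A.2.1.continuous).integrable_of_hasCompactSupport
        ((show HasCompactSupport A.1 from A.2.2).mul_left (f := v)))
      (hG1.continuous.integrable_of_hasCompactSupport hGc)
  · have := hGc.integral_Ioi_deriv_eq hG1 0
    rw [hGd] at this
    rw [this]
    simp [G, h0]

/-- Let `p ∈ ℂ[t]` with `deg p ≥ 2`. Then `S_p` does not have the concatenability property: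
there exist continuously differentiable `u₁, u₂ ∈ S_p` with `u₁(0) = u₂(0)` such that
`u₁ ⌢ u₂ ∉ S_p`. -/
theorem not_concatenable_of_degree_ge_two (p : Polynomial ℂ) (hp : 2 ≤ p.natDegree) :
    ∃ u₁ u₂ : ℝ → ℂ, MemSp p u₁ ∧ MemSp p u₂ ∧
      ContDiff ℝ 1 u₁ ∧ ContDiff ℝ 1 u₂ ∧ u₁ 0 = u₂ 0 ∧ ¬ MemSp p (concat u₁ u₂) := by
  obtain ⟨l, m, q, hq, hpq⟩ : ∃ (l m : ℂ) (q : Polynomial ℂ), q ≠ 0 ∧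
      p = ((Polynomial.X - Polynomial.C l) * (Polynomial.X - Polynomial.C m)) * q := by
    have hp0 : p ≠ 0 := by rintro rfl; simp at hp
    obtain ⟨l, hl⟩ := IsAlgClosed.exists_root p
      (fun h => by have : _ = 0 := Polynomial.natDegree_eq_of_degree_eq_some h; omega)
    obtain ⟨r, hr⟩ := Polynomial.dvd_iff_isRoot.2 hl
    have hr0 : r ≠ 0 := by rintro rfl; simp at hr; exact hp0 hr
    have hdeg : p.natDegree = 1 + r.natDegree := by
      rw [hr, Polynomial.natDegree_mul (Polynomial.X_sub_C_ne_zero l) hr0,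
        Polynomial.natDegree_X_sub_C]
    obtain ⟨m, hm⟩ := IsAlgClosed.exists_root r
      (fun h => by have : _ = 0 := Polynomial.natDegree_eq_of_degree_eq_some h; omega)
    obtain ⟨q, hq⟩ := Polynomial.dvd_iff_isRoot.2 hm
    refine ⟨l, m, q, ?_, by rw [hr, hq, mul_assoc]⟩
    rintro rfl; simp at hq; exact hr0 hq
  obtain ⟨v, v', h1, h2, h0, h0'⟩ := exists_v l m
  have hvc : Continuous v := continuous_iff_continuousAt.2 fun t => (h1 t).continuousAt
  have hvc' : Continuous v' := continuous_iff_continuousAt.2 fun t => (h2 t).continuousAt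
  refine ⟨fun _ => 0, v, ⟨continuous_const, ?_⟩, ⟨hvc, ?_⟩, contDiff_const, ?_, h0.symm, ?_⟩
  · intro φ _ _; simp
  · rw [isDistSol_iff p v hvc]
    intro φ
    rw [hpq, map_mul, Module.End.mul_apply]
    exact (pairing l m v v' h1 h2 h0 _).1
  · rw [contDiff_one_iff_deriv]
    refine ⟨fun t => (h1 t).differentiableAt, ?_⟩
    rwa [show deriv v = v' from funext fun t => (h1 t).deriv]
  · rintro ⟨hc, hs⟩
    rw [isDistSol_iff p _ hc] at hs
    obtain ⟨φ, hφ⟩ := exists_test q hq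
    have h := hs φ
    rw [hpq, map_mul, Module.End.mul_apply] at h
    have h3 := (pairing l m v v' h1 h2 h0 (Polynomial.aeval nD q φ)).2
    rw [← integral_indicator measurableSet_Ioi] at h3
    refine mul_ne_zero h0' hφ ?_
    rw [← h3, ← h]
    congr 1
    ext t
    by_cases ht : t ≤ 0
    · simp [concat, ht]
    · simp [concat, ht, not_le.1 ht]
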